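/- Let (X,σ) be an infinite minimal one-sided shift and let (X̄,σ̄) be its two-sided version. Then the number of right asymptotic σ̄-orbits of X̄ is at most the sum, over all branch points x of X, of the order of x (the number of σ-preimages of x in X). -/

import Mathlib

/-- The one-sided shift map on `A^ℕ`. -/
def shiftN {A : Type*} (x : ℕ → A) : ℕ → A := fun n => x (n + 1)

/-- The complexity function: the number of words of length `n` occurring in points of `X`. -/
noncomputable def complexityN {A : Type*} [Fintype A] (X : Set (ℕ → A)) (n : ℕ) : ℕ :=
  Nat.card {w : Fin n → A | ∃ x ∈ X, ∃ i : ℕ, ∀ j : Fin n, w j = x (i + (j : ℕ))}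

/-- `X` has sublinear complexity: `p(n) ≤ C n` for all `n ≥ 1`. -/
def SublinearComplexityN {A : Type*} [Fintype A] (X : Set (ℕ → A)) : Prop :=
  ∃ C : ℕ, ∀ n : ℕ, 1 ≤ n → complexityN X n ≤ C * n

/-- Minimality of a one-sided shift: every forward orbit is dense in `X`. -/
def MinimalN {A : Type*} [TopologicalSpace A] (X : Set (ℕ → A)) : Prop :=
  ∀ x ∈ X, X ⊆ closure {y : ℕ → A | ∃ n : ℕ, y = shiftN^[n] x}

/-- The two-sided shift map on `A^ℤ`. -/
def shiftZ {A : Type*} (x : ℤ → A) : ℤ → A := fun n => x (n + 1)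

/-- The `n`-th power of the two-sided shift, `n ∈ ℤ`. -/
def shiftZIter {A : Type*} (n : ℤ) (x : ℤ → A) : ℤ → A := fun m => x (m + n)

/-- The (two-sided) shift orbit of a point. -/
def orbitZ {A : Type*} (x : ℤ → A) : Set (ℤ → A) :=
  Set.range fun n : ℤ => shiftZIter n x

/-- Two points of `A^ℤ` are right asymptotic if they eventually agree to the right. -/
def RightAsymptotic {A : Type*} (x y : ℤ → A) : Prop :=
  ∃ N : ℤ, ∀ n : ℤ, N ≤ n → x n = y n

/-- Two (sets thought of as) orbits contain right asymptotic points. -/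
def OrbitsContainRA {A : Type*} (O O' : Set (ℤ → A)) : Prop :=
  ∃ p ∈ O, ∃ q ∈ O', RightAsymptotic p q

/-- `O` is a right asymptotic orbit of `X`: it is the orbit of a point of `X` and it is
right asymptotic to some orbit of a point of `X` disjoint from it. -/
def IsRAOrbit {A : Type*} (X : Set (ℤ → A)) (O : Set (ℤ → A)) : Prop :=
  (∃ x ∈ X, O = orbitZ x) ∧
    ∃ y ∈ X, O ∩ orbitZ y = ∅ ∧ OrbitsContainRA O (orbitZ y)

/-- `x` is a branch point of `X`: it lies in `X` and has at least two σ-preimages in `X`. -/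
def IsBranchPoint {A : Type*} (X : Set (ℕ → A)) (x : ℕ → A) : Prop :=
  x ∈ X ∧ ∃ y ∈ X, ∃ z ∈ X, y ≠ z ∧ shiftN y = x ∧ shiftN z = x

/-- The two-sided version of the one-sided shift `X`: all bi-infinite sequences all of
whose finite blocks occur in points of `X`. -/
def twoSidedVersion {A : Type*} (X : Set (ℕ → A)) : Set (ℤ → A) :=
  {y : ℤ → A | ∀ i : ℤ, ∀ n : ℕ, ∃ x ∈ X, ∃ m : ℕ,
    ∀ j : Fin n, y (i + ((j : ℕ) : ℤ)) = x (m + (j : ℕ))}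

theorem ENat.hasSum_iSup {ι : Type*} (f : ι → ℕ∞) : HasSum f (⨆ s : Finset ι, ∑ i ∈ s, f i) :=
  hasSum_of_isLUB _ isLUB_iSup

theorem ENat.tsum_eq_top_of_infinite {ι : Type*} [Infinite ι] {f : ι → ℕ∞}
    (hf : ∀ i, 1 ≤ f i) : ∑' i, f i = ⊤ := by
  refine ENat.eq_top_iff_forall_ge.2 fun n => ?_
  obtain ⟨s, rfl⟩ := Infinite.exists_subset_card_eq ι n
  calc (s.card : ℕ∞) = ∑ _i ∈ s, 1 := by simp
    _ ≤ ∑ i ∈ s, f i := Finset.sum_le_sum fun i _ => hf i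
    _ ≤ ∑' i, f i := (ENat.hasSum_iSup f).summable.sum_le_tsum s fun _ _ => zero_le

/-- The one-sided sequence read off a bi-infinite one from position `n` on. -/
def rightTail {A : Type*} (p : ℤ → A) (n : ℤ) : ℕ → A := fun k => p (n + k)

section

variable {A : Type*}

theorem shiftN_iterate_apply (k : ℕ) (x : ℕ → A) (n : ℕ) : shiftN^[k] x n = x (n + k) := by
  induction k generalizing x with
  | zero => rfl
  | succ k ih => rw [Function.iterate_succ_apply, ih]; rfl

theorem shiftN_iterate_mem {X : Set (ℕ → A)} (hinv : ∀ x ∈ X, shiftN x ∈ X) {x : ℕ → A}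
    (hx : x ∈ X) (k : ℕ) : shiftN^[k] x ∈ X := by
  induction k with
  | zero => exact hx
  | succ k ih => rw [Function.iterate_succ_apply']; exact hinv _ ih

theorem shiftN_iterate_rightTail (p : ℤ → A) (n : ℤ) (k : ℕ) :
    shiftN^[k] (rightTail p n) = rightTail p (n + k) := by
  funext j
  rw [shiftN_iterate_apply]
  simp only [rightTail]
  congr 1
  push_cast
  ring

theorem shiftN_rightTail (p : ℤ → A) (n : ℤ) :
    shiftN (rightTail p n) = rightTail p (n + 1) := by
  simpa using shiftN_iterate_rightTail p n 1

theorem rightTail_shiftZIter (p : ℤ → A) (m n : ℤ) :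
    rightTail (shiftZIter m p) n = rightTail p (n + m) := by
  funext k
  simp only [rightTail, shiftZIter]
  congr 1
  ring

theorem shiftZIter_shiftZIter (m n : ℤ) (x : ℤ → A) :
    shiftZIter m (shiftZIter n x) = shiftZIter (m + n) x := by
  funext k
  simp only [shiftZIter, add_assoc]

theorem orbitZ_shiftZIter (n : ℤ) (x : ℤ → A) : orbitZ (shiftZIter n x) = orbitZ x := by
  ext y
  constructor
  · rintro ⟨m, rfl⟩
    exact ⟨m + n, (shiftZIter_shiftZIter m n x).symm⟩
  · rintro ⟨m, rfl⟩
    refine ⟨m - n, ?_⟩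
    simp only [shiftZIter_shiftZIter, sub_add_cancel]

theorem shiftZIter_mem_twoSidedVersion {X : Set (ℕ → A)} {p : ℤ → A}
    (hp : p ∈ twoSidedVersion X) (n : ℤ) : shiftZIter n p ∈ twoSidedVersion X := by
  intro i k
  obtain ⟨x, hx, m, h⟩ := hp (i + n) k
  refine ⟨x, hx, m, fun j => ?_⟩
  rw [← h j, shiftZIter, add_right_comm]

/-- A bi-infinite sequence is determined by a right tail if there is no branching to its left. -/
theorem eq_of_rightTail_eq_of_not_isBranchPoint {X : Set (ℕ → A)} {p q : ℤ → A}
    (hp : ∀ n, rightTail p n ∈ X) (hq : ∀ n, rightTail q n ∈ X) {m : ℤ}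
    (hbranch : ∀ n ≤ m, ¬ IsBranchPoint X (rightTail p n))
    (h : rightTail p m = rightTail q m) : p = q := by
  have key (k : ℕ) : rightTail p (m - k) = rightTail q (m - k) := by
    induction k with
    | zero => simpa using h
    | succ k ih =>
      by_contra hne
      have hshift (r : ℤ → A) :
          shiftN (rightTail r (m - (k + 1 : ℕ))) = rightTail r (m - k) := by
        rw [shiftN_rightTail]
        congr 1
        push_cast
        ring
      exact hbranch (m - k) (by omega)
        ⟨hp _, _, hp _, _, hq _, hne, hshift p, (hshift q).trans ih.symm⟩
  funext i
  have := congrFun (key (m - i).toNat) (i - (m - (m - i).toNat)).toNat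
  simp only [rightTail] at this
  rwa [show m - ((m - i).toNat : ℤ) + ((i - (m - (m - i).toNat)).toNat : ℤ) = i by omega] at this

/-- Two distinct right asymptotic sequences split at a last position. -/
theorem RightAsymptotic.exists_rightTail_eq {p q : ℤ → A} (h : RightAsymptotic p q)
    (hne : p ≠ q) : ∃ n, rightTail p n ≠ rightTail q n ∧
      rightTail p (n + 1) = rightTail q (n + 1) := by
  obtain ⟨N, hN⟩ := h
  obtain ⟨i, hi⟩ := Function.ne_iff.1 hne
  obtain ⟨n, hn, hmax⟩ := Int.exists_greatest_of_bdd (P := fun j => p j ≠ q j)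
    ⟨N, fun j hj => le_of_not_ge fun hNj => hj (hN j hNj)⟩ ⟨i, hi⟩
  refine ⟨n, fun h => hn (by simpa [rightTail] using congrFun h 0), ?_⟩
  funext k
  by_contra hk
  have := hmax _ hk
  omega

section Topology

variable [TopologicalSpace A] {X : Set (ℕ → A)}

open Filter Topology in
theorem rightTail_mem_of_mem_twoSidedVersion (hclosed : IsClosed X)
    (hinv : ∀ x ∈ X, shiftN x ∈ X) {p : ℤ → A} (hp : p ∈ twoSidedVersion X) (n : ℤ) :
    rightTail p n ∈ X := by
  choose x hx m h using hp n
  refine hclosed.mem_of_tendsto (f := fun k => shiftN^[m k] (x k)) (b := atTop) ?_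
    (Eventually.of_forall fun k => shiftN_iterate_mem hinv (hx k) (m k))
  refine tendsto_pi_nhds.2 fun j => tendsto_nhds_of_eventually_eq ?_
  filter_upwards [eventually_gt_atTop j] with k hk
  rw [shiftN_iterate_apply, add_comm]
  exact (h k ⟨j, hk⟩).symm

variable [DiscreteTopology A]

theorem MinimalN.not_isPeriodicPt (hmin : MinimalN X) (hinf : X.Infinite) {x : ℕ → A}
    (hx : x ∈ X) {k : ℕ} (hk : 0 < k) : ¬ Function.IsPeriodicPt shiftN k x := by
  intro hper
  have hfin : {y : ℕ → A | ∃ n : ℕ, y = shiftN^[n] x}.Finite := by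
    refine ((Set.finite_Iio k).image fun n => shiftN^[n] x).subset ?_
    rintro _ ⟨n, rfl⟩
    exact ⟨n % k, Nat.mod_lt n hk, hper.iterate_mod_apply n⟩
  exact hinf (hfin.subset (hfin.isClosed.closure_eq ▸ hmin x hx))

theorem MinimalN.rightTail_injective (hmin : MinimalN X) (hinf : X.Infinite) {p : ℤ → A}
    (hp : ∀ n, rightTail p n ∈ X) : Function.Injective (rightTail p) := by
  refine Function.Injective.of_lt_imp_ne fun m n hmn h => ?_
  refine hmin.not_isPeriodicPt hinf (hp m) (k := (n - m).toNat) (by omega) ?_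
  rw [Function.IsPeriodicPt, Function.IsFixedPt, shiftN_iterate_rightTail, h]
  congr 1
  omega

/-- If there are finitely many branch points, every right asymptotic orbit contains a point whose
leftmost branching takes place at the origin. -/
theorem IsRAOrbit.exists_first_branch (hclosed : IsClosed X) (hinv : ∀ x ∈ X, shiftN x ∈ X)
    (hmin : MinimalN X) (hinf : X.Infinite) (hfin : {x | IsBranchPoint X x}.Finite)
    {O : Set (ℤ → A)} (hO : IsRAOrbit (twoSidedVersion X) O) :
    ∃ p, O = orbitZ p ∧ (∀ n, rightTail p n ∈ X) ∧
      IsBranchPoint X (shiftN (rightTail p (-1))) ∧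
      ∀ n ≤ -1, ¬ IsBranchPoint X (rightTail p n) := by
  obtain ⟨⟨x, hx, rfl⟩, y, hy, hdisj, _, ⟨a, rfl⟩, _, ⟨b, rfl⟩, hpq⟩ := hO
  have hne : shiftZIter a x ≠ shiftZIter b y := fun h =>
    (hdisj ▸ ⟨⟨a, rfl⟩, ⟨b, h.symm⟩⟩ : shiftZIter a x ∈ (∅ : Set (ℤ → A)))
  dsimp only at hpq
  have hp := rightTail_mem_of_mem_twoSidedVersion hclosed hinv
    (shiftZIter_mem_twoSidedVersion hx a)
  have hq := rightTail_mem_of_mem_twoSidedVersion hclosed hinv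
    (shiftZIter_mem_twoSidedVersion hy b)
  rw [← orbitZ_shiftZIter a x]
  generalize shiftZIter a x = p at *
  generalize shiftZIter b y = q at *
  obtain ⟨n, hn, hn'⟩ := hpq.exists_rightTail_eq hne
  have hbr : IsBranchPoint X (rightTail p (n + 1)) :=
    ⟨hp _, _, hp n, _, hq n, hn, shiftN_rightTail p n, (shiftN_rightTail q n).trans hn'.symm⟩
  obtain ⟨m, hm, hmin'⟩ := Set.exists_min_image _ id
    (hfin.preimage (hmin.rightTail_injective hinf hp).injOn) ⟨n + 1, hbr⟩
  refine ⟨shiftZIter m p, (orbitZ_shiftZIter m p).symm, fun k => ?_, ?_, fun k hk hb => ?_⟩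
  · rw [rightTail_shiftZIter]
    exact hp _
  · rw [shiftN_rightTail, rightTail_shiftZIter]
    simpa using hm
  · rw [rightTail_shiftZIter] at hb
    have : m ≤ k + m := hmin' _ hb
    omega

end Topology

end

/-- The number of right asymptotic orbits of the two-sided version of an
infinite minimal one-sided shift `X` is at most the sum, over all branch points `x` of
`X`, of the order of `x` (the number of σ-preimages of `x` in `X`). -/
theorem card_RA_orbits_le_sum_branch_orders
    {A : Type*} [Fintype A] [TopologicalSpace A] [DiscreteTopology A]
    (X : Set (ℕ → A)) (hne : X.Nonempty) (hclosed : IsClosed X)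
    (hinv : ∀ x ∈ X, shiftN x ∈ X)
    (hmin : MinimalN X) (hinf : X.Infinite) :
    {O : Set (ℤ → A) | IsRAOrbit (twoSidedVersion X) O}.encard ≤
      ∑' x : {x : ℕ → A // IsBranchPoint X x},
        {y : ℕ → A | y ∈ X ∧ shiftN y = (x : ℕ → A)}.encard := by
  rcases finite_or_infinite {x : ℕ → A // IsBranchPoint X x} with hB | hB
  · have : Nonempty (ℤ → A) := hne.elim fun x _ => ⟨fun _ => x 0⟩
    choose! p hO hp hbr hfirst using fun O (hO : IsRAOrbit (twoSidedVersion X) O) =>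
      hO.exists_first_branch hclosed hinv hmin hinf hB
    have := Fintype.ofFinite {x : ℕ → A // IsBranchPoint X x}
    rw [tsum_fintype]
    refine le_trans ?_ (Set.encard_iUnion_le_of_fintype _)
    refine Set.encard_le_encard_of_injOn (f := fun O => rightTail (p O) (-1)) ?_ ?_
    · intro O h
      exact Set.mem_iUnion.2 ⟨⟨_, hbr O h⟩, hp O h _, rfl⟩
    · intro O h O' h' heq
      rw [hO O h, hO O' h',
        eq_of_rightTail_eq_of_not_isBranchPoint (hp O h) (hp O' h') (hfirst O h) heq]
  · rw [ENat.tsum_eq_top_of_infinite]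
    · exact le_top
    · rintro ⟨x, _, y, hy, _, _, _, hyx, _⟩
      exact Set.one_le_encard_iff_nonempty.2 ⟨y, hy, hyx⟩
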